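/- The map ι_n : Π × ℤ → Π^n × ℤ^n, (λ, s) ↦ ((λ^(1),…,λ^(n)), (s_1,…,s_n)), is a bijection; moreover for each fixed s ∈ ℤ it restricts to a bijection from Π × {s} onto {((λ^(1),…,λ^(n)), (s_1,…,s_n)) ∈ Π^n × ℤ^n : s_1 + ⋯ + s_n = s}. -/

import Mathlib

/-!
STATEMENT 2.  Fix `n > 1`, `l > 1`.  A partition is an antitone, eventually zero
sequence `ℕ → ℕ` (0-indexed: `λ.1 i` is the paper's `λ_{i+1}`).

Every integer `k` is uniquely `k = a + n(b-1) - n*l*m` with `a ∈ {1,…,n}`,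
`b ∈ {1,…,l}`, `m ∈ ℤ`; the coordinates are given by `aC`, `bC`, `mC` below.

Given `(λ, s)`, put `k i = λ_{i+1} + s - i`.  `IotaNSpec n l λ s λT sT` says that for
each `a ∈ {1,…,n}` (encoded as `a : Fin n`, representing `a+1`), the strictly
decreasing sequence `i ↦ λT(a)_{i+1} + sT a - i` enumerates the set
`{b_i - l m_i : a_i = a}`: this is the defining property of `ι_n (λ, s) = (λT, sT)`.

The theorem: there is a map `ι` satisfying this specification, it is a bijection
`Π × ℤ → Π^n × ℤ^n`, and for each fixed `s` it restricts to a bijection from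
`Π × {s}` onto `{(λT, sT) : Σ_a sT a = s}`.
-/

def Ptn : Type := {f : ℕ → ℕ // Antitone f ∧ ∃ N : ℕ, ∀ i ≥ N, f i = 0}

/-- the `a`-coordinate of `k`: `a ∈ {1,…,n}` with `k ≡ a + n(b-1) (mod n*l)`. -/
def aC (n k : ℤ) : ℤ := (k - 1) % n + 1

/-- the `b`-coordinate of `k`. -/
def bC (n l k : ℤ) : ℤ := (k - 1) % (n * l) / n + 1

/-- the `m`-coordinate of `k`, so that `k = a + n(b-1) - n*l*m`. -/
def mC (n l k : ℤ) : ℤ := (aC n k + n * (bC n l k - 1) - k) / (n * l)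

/-- The defining property of `ι_n (λ, s) = (λT, sT)`. -/
def IotaNSpec (n l : ℕ) (lam : Ptn) (s : ℤ) (lamT : Fin n → Ptn) (sT : Fin n → ℤ) :
    Prop :=
  ∀ a : Fin n,
    Set.range (fun i : ℕ => ((lamT a).1 i : ℤ) + sT a - i) =
      {x : ℤ | ∃ i : ℕ,
        aC n ((lam.1 i : ℤ) + s - i) = (a : ℤ) + 1 ∧
        x = bC n l ((lam.1 i : ℤ) + s - i)
              - l * mC n l ((lam.1 i : ℤ) + s - i)}

open Filter

/-- The beta-set `{λ_{i+1} + s - i : i ∈ ℕ}` of a charged partition. -/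
def betaSet (p : Ptn × ℤ) : Set ℤ := Set.range fun i : ℕ => (p.1.1 i : ℤ) + p.2 - i

/-- A Maya diagram: a set of integers containing all sufficiently small integers and no
sufficiently large ones. -/
def IsMaya (S : Set ℤ) : Prop := (∀ᶠ k in atBot, k ∈ S) ∧ ∀ᶠ k in atTop, k ∉ S

/-- The elements of `S` congruent to `a + 1` modulo `n`, rescaled. -/
def residuePart (n : ℕ) (a : Fin n) (S : Set ℤ) : Set ℤ := {x | n * (x - 1) + a + 1 ∈ S}

theorem betaSet_strictAnti (p : Ptn × ℤ) :
    StrictAnti fun i : ℕ => (p.1.1 i : ℤ) + p.2 - i := by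
  intro i j hij
  have := p.1.2.1 hij.le
  dsimp only
  omega

theorem exists_bound_betaSet (p : Ptn × ℤ) :
    ∃ N : ℕ, ∀ M : ℤ, M ≤ p.2 - N →
      betaSet p ∩ Set.Ioi M = (fun i : ℕ => (p.1.1 i : ℤ) + p.2 - i) ''
        (Finset.range (p.2 - M).toNat : Set ℕ) ∧ M ∈ betaSet p := by
  obtain ⟨N, hN⟩ := p.1.2.2
  refine ⟨N, fun M hM => ⟨?_, ?_⟩⟩
  · ext k
    simp only [betaSet, Set.mem_inter_iff, Set.mem_range, Set.mem_Ioi, Set.mem_image,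
      Finset.coe_range, Set.mem_Iio]
    constructor
    · rintro ⟨⟨i, rfl⟩, hi⟩
      refine ⟨i, ?_, rfl⟩
      by_contra h
      have := hN i (by omega)
      omega
    · rintro ⟨i, hi, rfl⟩
      exact ⟨⟨i, rfl⟩, by omega⟩
  · refine ⟨(p.2 - M).toNat, ?_⟩
    have := hN (p.2 - M).toNat (by omega)
    simp only
    omega

theorem eventually_card_betaSet (p : Ptn × ℤ) :
    ∀ᶠ M in atBot, Finite ↥(betaSet p ∩ Set.Ioi M) ∧
      (Nat.card ↥(betaSet p ∩ Set.Ioi M) : ℤ) = p.2 - M := by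
  obtain ⟨N, hN⟩ := exists_bound_betaSet p
  filter_upwards [eventually_le_atBot (p.2 - N)] with M hM
  rw [(hN M hM).1]
  refine ⟨((Finset.finite_toSet _).image _).to_subtype, ?_⟩
  rw [Nat.card_image_of_injective (betaSet_strictAnti p).injective]
  simp only [Finset.coe_sort_coe, Nat.card_eq_fintype_card, Fintype.card_coe, Finset.card_range]
  omega

theorem isMaya_betaSet (p : Ptn × ℤ) : IsMaya (betaSet p) := by
  constructor
  · obtain ⟨N, hN⟩ := exists_bound_betaSet p
    filter_upwards [eventually_le_atBot (p.2 - N)] with M hM using (hN M hM).2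
  · filter_upwards [eventually_gt_atTop ((p.1.1 0 : ℤ) + p.2)] with k hk
    rintro ⟨i, rfl⟩
    have := p.1.2.1 (Nat.zero_le i)
    simp only at hk
    omega

theorem betaSet_injective : Function.Injective betaSet := by
  intro p q h
  have hfun : ∀ i : ℕ, (p.1.1 i : ℤ) + p.2 - i = (q.1.1 i : ℤ) + q.2 - i := by
    have hp : StrictMono fun i : ℕ => -((p.1.1 i : ℤ) + p.2 - i) := (betaSet_strictAnti p).neg
    have hq : StrictMono fun i : ℕ => -((q.1.1 i : ℤ) + q.2 - i) := (betaSet_strictAnti q).neg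
    have hneg := (hp.range_inj hq).1 (by
      have := congrArg (fun S : Set ℤ => (fun x => -x) '' S) h
      simpa only [betaSet, ← Set.range_comp, Function.comp_def] using this)
    intro i
    exact neg_injective (congrFun hneg i)
  obtain ⟨N, hN⟩ := p.1.2.2
  obtain ⟨N', hN'⟩ := q.1.2.2
  have hs : p.2 = q.2 := by
    have := hfun (max N N')
    have h1 := hN (max N N') (le_max_left _ _)
    have h2 := hN' (max N N') (le_max_right _ _)
    simp only [h1, h2] at this
    omega
  refine Prod.ext (Subtype.ext (funext fun i => ?_)) hs
  have : (p.1.1 i : ℤ) + p.2 - i = (q.1.1 i : ℤ) + q.2 - i := hfun i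
  omega

theorem IsMaya.exists_betaSet_eq {S : Set ℤ} (hS : IsMaya S) : ∃ p, betaSet p = S := by
  classical
  obtain ⟨L, hL⟩ := eventually_atBot.1 hS.1
  obtain ⟨U, hU⟩ := eventually_atTop.1 hS.2
  let T : Set ℕ := {j | U - j ∈ S}
  have hT : ∀ j : ℕ, (U - L).toNat ≤ j → j ∈ T := fun j hj => hL _ (by omega)
  have : Infinite T := by
    refine Set.infinite_coe_iff.2 (Set.infinite_of_forall_exists_gt fun m => ?_)
    exact ⟨max (m + 1) (U - L).toNat, hT _ (le_max_right _ _), by omega⟩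
  let f := Nat.orderEmbeddingOfSet T
  have hf : StrictMono f := f.strictMono
  have hrange : Set.range f = T := Nat.orderEmbeddingOfSet_range T
  have hle : ∀ i, i ≤ f i := fun _ => hf.le_apply
  have hmono : ∀ i j, i ≤ j → f i + j ≤ f j + i := by
    intro i j hij
    induction j, hij using Nat.le_induction with
    | base => rfl
    | succ j _ ih => have := hf (Nat.lt_add_one j); omega
  -- Beyond the threshold the enumeration skips nothing.
  have hstep : ∀ i, (U - L).toNat ≤ i → f (i + 1) = f i + 1 := by
    intro i hi
    have hmem : f i + 1 ∈ Set.range f := hrange ▸ hT _ (by have := hle i; omega)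
    obtain ⟨j, hj⟩ := hmem
    have h1 : i < j := hf.lt_iff_lt.1 (by omega)
    have h2 := hf.monotone (Nat.succ_le_of_lt h1)
    have h3 := hf (Nat.lt_add_one i)
    simp only [Nat.succ_eq_add_one] at h2
    omega
  set I := (U - L).toNat
  have hconst : ∀ i, I ≤ i → f i + I = f I + i := by
    intro i hi
    induction i, hi using Nat.le_induction with
    | base => rfl
    | succ i hi ih => rw [hstep i hi]; omega
  have hbound : ∀ i, f i + I ≤ f I + i := by
    intro i
    rcases le_total i I with h | h
    · exact hmono i I h
    · exact (hconst i h).le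
  refine ⟨(⟨fun i => f I + i - (f i + I), ?_, I, ?_⟩, U - (f I - I)), ?_⟩
  · intro i j hij
    have := hmono i j hij
    simp only
    omega
  · intro i hi
    have := hconst i hi
    simp only
    omega
  · ext k
    simp only [betaSet, Set.mem_range]
    constructor
    · rintro ⟨i, rfl⟩
      have h1 : f i ∈ T := hrange ▸ ⟨i, rfl⟩
      have h2 : U - (f i : ℤ) ∈ S := h1
      have h3 := hbound i
      convert h2 using 1
      omega
    · intro hk
      have hkU : k < U := by
        by_contra h
        exact hU k (by omega) hk
      have hmem : (U - k).toNat ∈ Set.range f := by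
        rw [hrange]
        change U - ((U - k).toNat : ℤ) ∈ S
        convert hk using 1
        omega
      obtain ⟨i, hi⟩ := hmem
      refine ⟨i, ?_⟩
      have := hbound i
      omega

theorem exists_eq_residue {n : ℕ} (hn : 0 < n) (k : ℤ) :
    ∃ (a : Fin n) (x : ℤ), (n : ℤ) * (x - 1) + a + 1 = k := by
  have hn' : (0 : ℤ) < n := by exact_mod_cast hn
  have h0 := Int.emod_nonneg (k - 1) hn'.ne'
  have h1 := Int.emod_lt_of_pos (k - 1) hn'
  refine ⟨⟨((k - 1) % n).toNat, by omega⟩, (k - 1) / n + 1, ?_⟩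
  have := Int.mul_ediv_add_emod (k - 1) n
  simp only [Int.toNat_of_nonneg h0, add_sub_cancel_right]
  omega

theorem residue_emod {n : ℕ} (a : Fin n) (x : ℤ) :
    ((n : ℤ) * (x - 1) + a + 1 - 1) % n = a := by
  have ha := a.2
  rw [add_sub_cancel_right, Int.mul_add_emod_self_left]
  exact Int.emod_eq_of_lt (by omega) (by omega)

theorem residue_inj {n : ℕ} {a b : Fin n} {x y : ℤ}
    (h : (n : ℤ) * (x - 1) + a + 1 = n * (y - 1) + b + 1) : a = b ∧ x = y := by
  have hab : a = b := by
    have := residue_emod a x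
    rw [h, residue_emod] at this
    exact Fin.ext (by omega)
  subst hab
  have hn : (n : ℤ) ≠ 0 := by have := a.2; omega
  have := mul_left_cancel₀ hn (show (n : ℤ) * (x - 1) = n * (y - 1) by omega)
  exact ⟨rfl, by omega⟩

theorem residue_le_iff {n : ℕ} (a : Fin n) (x N : ℤ) :
    (n : ℤ) * (x - 1) + a + 1 ≤ n * N ↔ x ≤ N := by
  have ha := a.2
  constructor
  · intro h
    by_contra! hx
    nlinarith
  · intro h
    nlinarith

theorem tendsto_residue_atBot {n : ℕ} (a : Fin n) :
    Tendsto (fun x : ℤ => (n : ℤ) * (x - 1) + a + 1) atBot atBot := by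
  have ha := a.2
  refine tendsto_atBot_mono' _ ?_ tendsto_id
  filter_upwards [eventually_le_atBot (0 : ℤ)] with x hx
  simp only [id]
  nlinarith

theorem tendsto_residue_atTop {n : ℕ} (a : Fin n) :
    Tendsto (fun x : ℤ => (n : ℤ) * (x - 1) + a + 1) atTop atTop := by
  have ha := a.2
  refine tendsto_atTop_mono' _ ?_ tendsto_id
  filter_upwards [eventually_ge_atTop (1 : ℤ)] with x hx
  simp only [id]
  nlinarith

theorem IsMaya.residuePart {n : ℕ} (a : Fin n) {S : Set ℤ} (hS : IsMaya S) :
    IsMaya (residuePart n a S) :=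
  ⟨(tendsto_residue_atBot a).eventually hS.1, (tendsto_residue_atTop a).eventually hS.2⟩

theorem eq_of_residuePart_eq {n : ℕ} (hn : 0 < n) {S T : Set ℤ}
    (h : ∀ a, residuePart n a S = residuePart n a T) : S = T := by
  ext k
  obtain ⟨a, x, rfl⟩ := exists_eq_residue hn k
  exact Set.ext_iff.1 (h a) x

theorem exists_isMaya_residuePart_eq {n : ℕ} (hn : 0 < n) (T : Fin n → Set ℤ)
    (hT : ∀ a, IsMaya (T a)) : ∃ S, IsMaya S ∧ ∀ a, residuePart n a S = T a := by
  let S : Set ℤ := {k | ∃ a : Fin n, ∃ x ∈ T a, (n : ℤ) * (x - 1) + a + 1 = k}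
  have hST : ∀ (a : Fin n) (x : ℤ), (n : ℤ) * (x - 1) + a + 1 ∈ S ↔ x ∈ T a := by
    intro a x
    constructor
    · rintro ⟨b, y, hy, h⟩
      obtain ⟨rfl, rfl⟩ := residue_inj h
      exact hy
    · exact fun hx => ⟨a, x, hx, rfl⟩
  refine ⟨S, ⟨?_, ?_⟩, fun a => Set.ext fun x => hST a x⟩
  · obtain ⟨L, hL⟩ := eventually_atBot.1 (eventually_all.2 fun a => (hT a).1)
    filter_upwards [eventually_le_atBot ((n : ℤ) * L)] with k hk
    obtain ⟨a, x, rfl⟩ := exists_eq_residue hn k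
    exact (hST a x).2 (hL x ((residue_le_iff a x L).1 hk) a)
  · obtain ⟨U, hU⟩ := eventually_atTop.1 (eventually_all.2 fun a => (hT a).2)
    filter_upwards [eventually_gt_atTop ((n : ℤ) * U)] with k hk
    obtain ⟨a, x, rfl⟩ := exists_eq_residue hn k
    rw [hST]
    refine hU x ?_ a
    have := (residue_le_iff a x U).not.1 (not_le.2 hk)
    omega

theorem card_inter_Ioi_eq_sum {n : ℕ} (hn : 0 < n) (S : Set ℤ) (N : ℤ)
    (hfin : ∀ a, Finite ↥(residuePart n a S ∩ Set.Ioi N)) :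
    Nat.card ↥(S ∩ Set.Ioi (n * N)) = ∑ a, Nat.card ↥(residuePart n a S ∩ Set.Ioi N) := by
  rw [← Nat.card_sigma]
  refine (Nat.card_congr (Equiv.ofBijective
    (fun q : Σ a, ↥(residuePart n a S ∩ Set.Ioi N) =>
      (⟨(n : ℤ) * (q.2.1 - 1) + q.1 + 1, q.2.2.1,
        not_le.1 ((residue_le_iff q.1 q.2.1 N).not.2 (not_le.2 q.2.2.2))⟩ :
          ↥(S ∩ Set.Ioi (n * N)))) ⟨?_, ?_⟩)).symm
  · rintro ⟨a, x, hx⟩ ⟨b, y, hy⟩ h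
    obtain ⟨rfl, rfl⟩ := residue_inj (Subtype.ext_iff.1 h)
    rfl
  · rintro ⟨k, hk, hkN⟩
    obtain ⟨a, x, rfl⟩ := exists_eq_residue hn k
    exact ⟨⟨a, x, hk, not_le.1 ((residue_le_iff a x N).not.1 (not_le.2 hkN))⟩, rfl⟩

theorem sum_charge_eq {n : ℕ} (hn : 0 < n) {p : Ptn × ℤ} {q : Fin n → Ptn × ℤ}
    (h : ∀ a, betaSet (q a) = residuePart n a (betaSet p)) : ∑ a, (q a).2 = p.2 := by
  have hn' : (0 : ℤ) < n := by exact_mod_cast hn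
  have hall := eventually_all.2 fun a => eventually_card_betaSet (q a)
  have hmul : Tendsto (fun N : ℤ => (n : ℤ) * N) atBot atBot := by
    refine tendsto_atBot_mono' _ ?_ tendsto_id
    filter_upwards [eventually_le_atBot (0 : ℤ)] with N hN
    simp only [id]
    nlinarith
  have hp := hmul.eventually (eventually_card_betaSet p)
  obtain ⟨N, hqN, -, hpN⟩ := (hall.and hp).exists
  simp only [h] at hqN
  rw [card_inter_Ioi_eq_sum hn _ _ fun a => (hqN a).1, Nat.cast_sum,
    Finset.sum_congr rfl fun a _ => (hqN a).2, Finset.sum_sub_distrib] at hpN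
  simp only [Finset.sum_const, Finset.card_univ, Fintype.card_fin, nsmul_eq_mul] at hpN
  linarith

theorem bC_sub_mul_mC {n l : ℕ} (hn : 0 < n) (hl : 0 < l) (k : ℤ) :
    bC n l k - l * mC n l k = (k - 1) / n + 1 := by
  have hn' : (0 : ℤ) < n := by exact_mod_cast hn
  have hl' : (0 : ℤ) < l := by exact_mod_cast hl
  have hdiv : (k - 1) % (n * l) / n = (k - 1) / n - l * ((k - 1) / (n * l)) := by
    rw [Int.emod_def, mul_assoc, sub_eq_add_neg, ← mul_neg, Int.add_mul_ediv_left _ _ hn'.ne',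
      ← sub_eq_add_neg]
  have hm : mC n l k = -((k - 1) / (n * l)) := by
    have hk := Int.mul_ediv_add_emod (k - 1) n
    rw [mC, bC, aC, hdiv]
    refine Int.ediv_eq_of_eq_mul_right (mul_pos hn' hl').ne' ?_
    linear_combination hk
  rw [hm, bC, hdiv]
  ring

theorem iotaNSpec_iff {n l : ℕ} (hn : 0 < n) (hl : 0 < l) (p : Ptn × ℤ) (lamT : Fin n → Ptn)
    (sT : Fin n → ℤ) :
    IotaNSpec n l p.1 p.2 lamT sT ↔
      ∀ a, betaSet (lamT a, sT a) = residuePart n a (betaSet p) := by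
  refine forall_congr' fun a => ?_
  suffices h : {x : ℤ | ∃ i : ℕ, aC n ((p.1.1 i : ℤ) + p.2 - i) = (a : ℤ) + 1 ∧
      x = bC n l ((p.1.1 i : ℤ) + p.2 - i) - l * mC n l ((p.1.1 i : ℤ) + p.2 - i)} =
      residuePart n a (betaSet p) by
    rw [h]
    rfl
  ext x
  simp only [bC_sub_mul_mC hn hl, aC, residuePart, betaSet, Set.mem_ofPred_eq, Set.mem_range]
  refine exists_congr fun i => ?_
  generalize (p.1.1 i : ℤ) + p.2 - i = k
  constructor
  · rintro ⟨ha, rfl⟩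
    have := Int.mul_ediv_add_emod (k - 1) n
    rw [add_sub_cancel_right]
    omega
  · rintro rfl
    have hmod := residue_emod a x
    have hdiv := Int.mul_ediv_add_emod ((n : ℤ) * (x - 1) + a + 1 - 1) n
    refine ⟨by omega, ?_⟩
    have hn' : (n : ℤ) ≠ 0 := by omega
    have := mul_left_cancel₀ hn'
      (show (n : ℤ) * (((n : ℤ) * (x - 1) + a + 1 - 1) / n) = n * (x - 1) by omega)
    omega

theorem stmt_2 (n l : ℕ) (hn : 1 < n) (hl : 1 < l) :
    ∃ ι : Ptn × ℤ → (Fin n → Ptn) × (Fin n → ℤ),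
      (∀ p : Ptn × ℤ, IotaNSpec n l p.1 p.2 (ι p).1 (ι p).2) ∧
      Function.Bijective ι ∧
      (∀ s : ℤ, Set.BijOn ι {p : Ptn × ℤ | p.2 = s}
        {q : (Fin n → Ptn) × (Fin n → ℤ) | (∑ a, q.2 a) = s}) := by
  have hn0 : 0 < n := by omega
  have hl0 : 0 < l := by omega
  choose r hr using fun (p : Ptn × ℤ) (a : Fin n) =>
    ((isMaya_betaSet p).residuePart a).exists_betaSet_eq
  let ι : Ptn × ℤ → (Fin n → Ptn) × (Fin n → ℤ) :=
    fun p => (fun a => (r p a).1, fun a => (r p a).2)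
  have hinj : Function.Injective ι := by
    intro p q h
    refine betaSet_injective (eq_of_residuePart_eq hn0 fun a => ?_)
    have hpq : r p a = r q a :=
      Prod.ext (congrFun (congrArg Prod.fst h) a) (congrFun (congrArg Prod.snd h) a)
    rw [← hr p a, ← hr q a, hpq]
  have hsurj : Function.Surjective ι := by
    intro q
    obtain ⟨S, hS, hSq⟩ := exists_isMaya_residuePart_eq hn0 (fun a => betaSet (q.1 a, q.2 a))
      fun a => isMaya_betaSet _
    obtain ⟨p, rfl⟩ := hS.exists_betaSet_eq
    have hpq : ∀ a, r p a = (q.1 a, q.2 a) := fun a =>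
      betaSet_injective ((hr p a).trans (hSq a))
    exact ⟨p, Prod.ext (funext fun a => congrArg Prod.fst (hpq a))
      (funext fun a => congrArg Prod.snd (hpq a))⟩
  have hsum : ∀ p, ∑ a, (ι p).2 a = p.2 := fun p => sum_charge_eq hn0 (hr p)
  refine ⟨ι, fun p => (iotaNSpec_iff hn0 hl0 p _ _).2 (hr p), ⟨hinj, hsurj⟩,
    fun s => ⟨?_, hinj.injOn, ?_⟩⟩
  · rintro p rfl
    exact hsum p
  · rintro q rfl
    obtain ⟨p, rfl⟩ := hsurj q
    exact ⟨p, (hsum p).symm, rfl⟩
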